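/- arXiv:2511.15332 — 3 statements merged into one kernel-verified Lean document; each statement's English description precedes it below -/
import Mathlib

section
/- Let τ > 0, λ ≥ 0, and let (x_i, y_i) ∈ ℝ^p × ℝ for i = 1,…,n with each ‖x_i‖₂ < ∞. Define L(β) = (1/n)∑_{i=1}^n ℓ_τ(y_i − x_iᵀβ) and F(β) = L(β) + λ‖β‖₁. Let β^{(0)} ∈ ℝ^p and for each t ≥ 0 let β^{(t+1)} be an exact minimizer of the surrogate Q^{(t)}(β) = (1/(2n))∑_{i=1}^n v_i^{(t)} (y_i − x_iᵀβ)² + λ‖β‖₁, where v_i^{(t)} = exp(−(τ/2)(y_i − x_iᵀβ^{(t)})²). Then the sequence of objective values is nonincreasing: F(β^{(t+1)}) ≤ F(β^{(t)}) for all t ≥ 0. -/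
open scoped BigOperators

/-- The exponential loss is majorized by its tangent quadratic. -/
theorem expLoss_le_tangent {τ : ℝ} (hτ : 0 < τ) (r s : ℝ) :
    (1 / τ) * (1 - Real.exp (-(τ * r ^ 2 / 2))) ≤
      (1 / τ) * (1 - Real.exp (-(τ * s ^ 2 / 2))) +
        (1 / 2) * (Real.exp (-(τ / 2) * s ^ 2) * r ^ 2 - Real.exp (-(τ / 2) * s ^ 2) * s ^ 2) := by
  have hv : Real.exp (-(τ * s ^ 2 / 2)) = Real.exp (-(τ / 2) * s ^ 2) := by ring_nf
  have hr : Real.exp (-(τ * r ^ 2 / 2)) =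
      Real.exp (-(τ / 2) * s ^ 2) * Real.exp (-(τ / 2) * (r ^ 2 - s ^ 2)) := by
    rw [← Real.exp_add]
    ring_nf
  rw [hv, hr]
  set v := Real.exp (-(τ / 2) * s ^ 2)
  have htangent := mul_le_mul_of_nonneg_left
    (Real.add_one_le_exp (-(τ / 2) * (r ^ 2 - s ^ 2))) (Real.exp_pos (-(τ / 2) * s ^ 2)).le
  have hsum : (1 / τ) * (1 - v) + (1 / 2) * (v * r ^ 2 - v * s ^ 2) =
      (1 / τ) * (1 - v * (-(τ / 2) * (r ^ 2 - s ^ 2) + 1)) := by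
    field_simp
    ring
  rw [hsum]
  gcongr

/-- MM descent: if each `β^{(t+1)}` exactly minimizes the weighted-Lasso surrogate
`Q^{(t)}(β) = (1/(2n))∑ᵢ vᵢ^{(t)}(yᵢ − xᵢᵀβ)² + λ‖β‖₁` with weights
`vᵢ^{(t)} = exp(−(τ/2)(yᵢ − xᵢᵀβ^{(t)})²)`, then the objective values
`F(β^{(t)}) = (1/n)∑ᵢ ℓ_τ(yᵢ − xᵢᵀβ^{(t)}) + λ‖β^{(t)}‖₁` are nonincreasing. -/
theorem mm_descent (τ lam : ℝ) (hτ : 0 < τ) (hlam : 0 ≤ lam) (n p : ℕ) (hn : 0 < n)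
    (x : Fin n → Fin p → ℝ) (y : Fin n → ℝ)
    (F : (Fin p → ℝ) → ℝ)
    (hF : F = fun β : Fin p → ℝ =>
      (1 / (n : ℝ)) * ∑ i, (1 / τ) *
          (1 - Real.exp (-(τ * (y i - ∑ j, x i j * β j) ^ 2 / 2)))
        + lam * ∑ j, |β j|)
    (B : ℕ → Fin p → ℝ)
    (hmm : ∀ t : ℕ, IsMinOn
      (fun β : Fin p → ℝ =>
        (1 / (2 * (n : ℝ))) * ∑ i,
            Real.exp (-(τ / 2) * (y i - ∑ j, x i j * B t j) ^ 2) *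
              (y i - ∑ j, x i j * β j) ^ 2
          + lam * ∑ j, |β j|)
      Set.univ (B (t + 1))) :
    ∀ t : ℕ, F (B (t + 1)) ≤ F (B t) := by
  intro t
  have hmin := isMinOn_iff.mp (hmm t) (B t) (Set.mem_univ _)
  have hloss := Finset.sum_le_sum fun i (_ : i ∈ Finset.univ) =>
    expLoss_le_tangent hτ (y i - ∑ j, x i j * B (t + 1) j) (y i - ∑ j, x i j * B t j)
  simp only [Finset.sum_add_distrib, ← Finset.mul_sum, Finset.sum_sub_distrib] at hloss
  have hmean := mul_le_mul_of_nonneg_left hloss (by positivity : 0 ≤ 1 / (n : ℝ))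
  have hhalf : 1 / (2 * (n : ℝ)) = 1 / (n : ℝ) * (1 / 2) := by
    field_simp
  simp only [hhalf] at hmin
  simp only [hF, ← Finset.mul_sum, Finset.sum_sub_distrib]
  linarith
end

section
/- Let τ > 0 and (x_i, y_i) ∈ ℝ^p × ℝ for i = 1,…,n, and define L(β) = (1/n)∑_{i=1}^n ℓ_τ(y_i − x_iᵀβ) and residuals r_i(β) = y_i − x_iᵀβ. Then for all β, β₀ ∈ ℝ^p, the weighted quadratic surrogate majorizes the loss: L(β) ≤ L(β₀) + (1/(2n))∑_{i=1}^n v_i(β₀)·(r_i(β)² − r_i(β₀)²), where v_i(β₀) = exp(−(τ/2) r_i(β₀)²), with equality when β = β₀. -/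
open scoped BigOperators

/-- Tangent-line bound: the concave map `a ↦ (1/τ)(1 − exp(−τa/2))` lies below its tangent at `b`. -/
theorem exp_loss_le_tangent {τ : ℝ} (hτ : 0 < τ) (a b : ℝ) :
    (1 / τ) * (1 - Real.exp (-(τ * a / 2))) ≤
      (1 / τ) * (1 - Real.exp (-(τ * b / 2))) +
        (1 / 2) * (Real.exp (-(τ / 2) * b) * (a - b)) := by
  have hb : -(τ / 2) * b = -(τ * b / 2) := by ring
  have hsplit : Real.exp (-(τ * a / 2)) =
      Real.exp (-(τ * b / 2)) * Real.exp (-(τ * (a - b) / 2)) := by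
    rw [← Real.exp_add]
    ring_nf
  have hexp : Real.exp (-(τ * b / 2)) * (-(τ * (a - b) / 2) + 1) ≤ Real.exp (-(τ * a / 2)) := by
    rw [hsplit]
    exact mul_le_mul_of_nonneg_left (Real.add_one_le_exp _) (Real.exp_pos _).le
  have htan : (1 / τ) * (1 - Real.exp (-(τ * b / 2))) +
      (1 / 2) * (Real.exp (-(τ * b / 2)) * (a - b)) =
      (1 / τ) * (1 - Real.exp (-(τ * b / 2)) * (-(τ * (a - b) / 2) + 1)) := by
    field_simp
    ring
  rw [hb, htan]
  gcongr

/-- Majorization: for `L(β) = (1/n)∑ᵢ ℓ_τ(yᵢ − xᵢᵀβ)` with residuals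
`rᵢ(β) = yᵢ − xᵢᵀβ`, the weighted quadratic surrogate majorizes the loss:
`L(β) ≤ L(β₀) + (1/(2n))∑ᵢ vᵢ(β₀)(rᵢ(β)² − rᵢ(β₀)²)` where
`vᵢ(β₀) = exp(−(τ/2) rᵢ(β₀)²)`, with equality when `β = β₀`. -/
theorem surrogate_majorizes_loss (τ : ℝ) (hτ : 0 < τ) (n p : ℕ) (hn : 0 < n)
    (x : Fin n → Fin p → ℝ) (y : Fin n → ℝ)
    (L : (Fin p → ℝ) → ℝ)
    (hL : L = fun β : Fin p → ℝ =>
      (1 / (n : ℝ)) * ∑ i, (1 / τ) *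
        (1 - Real.exp (-(τ * (y i - ∑ j, x i j * β j) ^ 2 / 2))))
    (β β₀ : Fin p → ℝ) :
    L β ≤ L β₀ + (1 / (2 * (n : ℝ))) * ∑ i,
        Real.exp (-(τ / 2) * (y i - ∑ j, x i j * β₀ j) ^ 2) *
          ((y i - ∑ j, x i j * β j) ^ 2 - (y i - ∑ j, x i j * β₀ j) ^ 2) ∧
    L β₀ = L β₀ + (1 / (2 * (n : ℝ))) * ∑ i,
        Real.exp (-(τ / 2) * (y i - ∑ j, x i j * β₀ j) ^ 2) *
          ((y i - ∑ j, x i j * β₀ j) ^ 2 - (y i - ∑ j, x i j * β₀ j) ^ 2) := by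
  subst hL
  refine ⟨?_, by simp⟩
  have hscale (S : ℝ) : (1 / (2 * (n : ℝ))) * S = (1 / (n : ℝ)) * ((1 / 2) * S) := by
    ring
  simp only [hscale]
  rw [← mul_add, Finset.mul_sum _ _ (1 / 2 : ℝ), ← Finset.sum_add_distrib]
  gcongr with i
  exact exp_loss_le_tangent hτ _ _
end

section
/- Let Δ, g ∈ ℝ^p, let S ⊆ {1,…,p} with |S| = s ≥ 1, and let κ > 0, λ > 0. Suppose ⟨g, Δ⟩ + κ‖Δ‖₂² ≤ λ(‖Δ_S‖₁ − ‖Δ_{S^c}‖₁) and ‖g‖_∞ ≤ λ/4. Then: (i) κ‖Δ‖₂² ≤ (5λ/4)‖Δ_S‖₁ − (3λ/4)‖Δ_{S^c}‖₁; (ii) ‖Δ_{S^c}‖₁ ≤ (5/3)‖Δ_S‖₁; (iii) ‖Δ‖₂ ≤ 5λ√s/(4κ); (iv) ‖Δ‖₁ ≤ 4√s·‖Δ‖₂. -/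
open scoped BigOperators

/-- The `ℓ¹` norm of the restriction of `x` to `S` is at most `√|S|` times the `ℓ²` norm of `x`. -/
lemma sum_abs_ite_mem_le_sqrt_card_mul_sqrt {ι : Type*} [Fintype ι] [DecidableEq ι]
    (x : ι → ℝ) (S : Finset ι) :
    (∑ j, |if j ∈ S then x j else 0|) ≤ √(S.card : ℝ) * √(∑ j, x j ^ 2) := by
  have hrestrict : (∑ j, |if j ∈ S then x j else 0|) = ∑ j ∈ S, |x j| := by
    simp [apply_ite abs, Finset.sum_ite_mem]
  have hcauchy : (∑ j ∈ S, |x j|) ^ 2 ≤ S.card * ∑ j ∈ S, |x j| ^ 2 :=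
    sq_sum_le_card_mul_sum_sq
  have hmono : (∑ j ∈ S, |x j| ^ 2) ≤ ∑ j, x j ^ 2 := by
    simp only [sq_abs]
    exact Finset.sum_le_univ_sum_of_nonneg fun j => sq_nonneg (x j)
  rw [hrestrict, ← Real.sqrt_mul (Nat.cast_nonneg _)]
  exact Real.le_sqrt_of_sq_le (hcauchy.trans (by gcongr))

/-- The `ℓ¹` norm splits over a set and its complement. -/
lemma sum_abs_eq_sum_abs_ite_mem_add {ι : Type*} [Fintype ι] [DecidableEq ι]
    (x : ι → ℝ) (S : Finset ι) :
    (∑ j, |x j|) = (∑ j, |if j ∈ S then x j else 0|) + ∑ j, |if j ∉ S then x j else 0| := by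
  rw [← Finset.sum_add_distrib]
  refine Finset.sum_congr rfl fun j _ => ?_
  by_cases hj : j ∈ S <;> simp [hj]

/-- Hölder's inequality for the pairing of `ℓ^∞` and `ℓ¹`, as a lower bound. -/
lemma neg_mul_sum_abs_le_sum_mul {ι : Type*} [Fintype ι] {g x : ι → ℝ} {c : ℝ}
    (hg : ∀ j, |g j| ≤ c) : -(c * ∑ j, |x j|) ≤ ∑ j, g j * x j := by
  rw [Finset.mul_sum, ← Finset.sum_neg_distrib]
  refine Finset.sum_le_sum fun j _ => (neg_le_neg ?_).trans (neg_abs_le (g j * x j))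
  rw [abs_mul]
  exact mul_le_mul_of_nonneg_right (hg j) (abs_nonneg _)

/-- Cone argument: if `⟨g,Δ⟩ + κ‖Δ‖₂² ≤ λ(‖Δ_S‖₁ − ‖Δ_{Sᶜ}‖₁)` and `‖g‖_∞ ≤ λ/4`,
with `|S| = s ≥ 1`, `κ > 0`, `λ > 0`, then
(i) `κ‖Δ‖₂² ≤ (5λ/4)‖Δ_S‖₁ − (3λ/4)‖Δ_{Sᶜ}‖₁`;
(ii) `‖Δ_{Sᶜ}‖₁ ≤ (5/3)‖Δ_S‖₁`;
(iii) `‖Δ‖₂ ≤ 5λ√s/(4κ)`;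
(iv) `‖Δ‖₁ ≤ 4√s·‖Δ‖₂`. -/
theorem cone_argument (p : ℕ) (Δ g : Fin p → ℝ) (S : Finset (Fin p)) (s : ℕ)
    (hcard : S.card = s) (hs : 1 ≤ s) (κ lam : ℝ) (hκ : 0 < κ) (hlam : 0 < lam)
    (h1 : (∑ j, g j * Δ j) + κ * (∑ j, (Δ j) ^ 2) ≤
      lam * ((∑ j, |if j ∈ S then Δ j else 0|) - (∑ j, |if j ∉ S then Δ j else 0|)))
    (h2 : ∀ j, |g j| ≤ lam / 4) :
    κ * (∑ j, (Δ j) ^ 2) ≤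
        (5 * lam / 4) * (∑ j, |if j ∈ S then Δ j else 0|)
          - (3 * lam / 4) * (∑ j, |if j ∉ S then Δ j else 0|) ∧
    (∑ j, |if j ∉ S then Δ j else 0|) ≤ (5 / 3) * (∑ j, |if j ∈ S then Δ j else 0|) ∧
    Real.sqrt (∑ j, (Δ j) ^ 2) ≤ 5 * lam * Real.sqrt s / (4 * κ) ∧
    (∑ j, |Δ j|) ≤ 4 * Real.sqrt s * Real.sqrt (∑ j, (Δ j) ^ 2) := by
  have hholder := neg_mul_sum_abs_le_sum_mul (x := Δ) h2
  have hS := sum_abs_ite_mem_le_sqrt_card_mul_sqrt Δ S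
  have hsplit := sum_abs_eq_sum_abs_ite_mem_add Δ S
  have hN : √(∑ j, Δ j ^ 2) ^ 2 = ∑ j, Δ j ^ 2 :=
    Real.sq_sqrt (Finset.sum_nonneg fun j _ => sq_nonneg (Δ j))
  have hB : 0 ≤ ∑ j, |if j ∉ S then Δ j else 0| := Finset.sum_nonneg fun j _ => abs_nonneg _
  rw [hcard] at hS
  rw [hsplit] at hholder ⊢
  rw [← hN] at h1
  nth_rw 1 [← hN]
  have hN0 : 0 ≤ √(∑ j, Δ j ^ 2) := Real.sqrt_nonneg _
  have hs0 : 0 ≤ √(s : ℝ) := Real.sqrt_nonneg _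
  generalize √(∑ j, Δ j ^ 2) = N at *
  generalize (∑ j, |if j ∈ S then Δ j else 0|) = A at *
  generalize (∑ j, |if j ∉ S then Δ j else 0|) = B at *
  generalize √(s : ℝ) = r at *
  have hbasic : κ * N ^ 2 ≤ 5 * lam / 4 * A - 3 * lam / 4 * B := by linarith
  have hcone : B ≤ 5 / 3 * A := by
    have hnonneg : 0 ≤ κ * N ^ 2 := by positivity
    refine le_of_mul_le_mul_left ?_ hlam
    linarith
  refine ⟨hbasic, hcone, ?_, ?_⟩
  · rcases hN0.eq_or_lt with rfl | hNpos
    · positivity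
    · rw [le_div_iff₀ (by positivity)]
      refine le_of_mul_le_mul_right ?_ hNpos
      have hlamA := mul_le_mul_of_nonneg_left hS hlam.le
      have hlamB := mul_nonneg hlam.le hB
      linarith
  · have hrN : 0 ≤ r * N := by positivity
    linarith
end
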